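/- arXiv:2412.04336 — 2 statements merged into one kernel-verified Lean document; each statement's English description precedes it below -/
import Mathlib

section
/- Let m_* ∈ (0,1) be the unique point with I(m_*) = 1/4, where I is the binary entropy function. Then for every m ∈ (−1,1) with |m| > m_*, there exists β ≥ 0 with β²(1−m²)² ≤ 1 such that it is NOT the case that lim_{N→∞} E[(1/N) log Z_{N,β,m}] = 0 (i.e., there exists β in the de Almeida–Thouless region AT_m that does not lie in the high temperature region HT_m). -/
open MeasureTheory ProbabilityTheory Real Filter
open scoped NNReal

noncomputable section

/-- The law of the i.i.d. Gaussian couplings `(g_{ij})_{1 ≤ i,j ≤ N}`, each `N(0, 1/N)`. -/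
def couplings (N : ℕ) : Measure (Fin N × Fin N → ℝ) :=
  Measure.pi fun _ : Fin N × Fin N => gaussianReal 0 ((N : ℝ≥0))⁻¹

/-- The spin value (`±1`) encoded by a Boolean. -/
def spin (b : Bool) : ℝ := if b then 1 else -1

/-- The base product measure weight `p_m(σ) = ∏ i, (1 + m σ_i)/2`. -/
def pm (N : ℕ) (m : ℝ) (σ : Fin N → Bool) : ℝ :=
  ∏ i : Fin N, (1 + m * spin (σ i)) / 2

/-- The Hamiltonian `H_{N,β,m}(σ)`. -/
def ham (N : ℕ) (β m : ℝ) (g : Fin N × Fin N → ℝ) (σ : Fin N → Bool) : ℝ :=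
  (β / Real.sqrt 2) * ∑ i : Fin N, ∑ j : Fin N,
      g (i, j) * (spin (σ i) - m) * (spin (σ j) - m)
    - (β ^ 2 / (4 * N)) * ∑ i : Fin N, ∑ j : Fin N,
      (spin (σ i) - m) ^ 2 * (spin (σ j) - m) ^ 2

/-- The partition function `Z_{N,β,m}`. -/
def Z (N : ℕ) (β m : ℝ) (g : Fin N × Fin N → ℝ) : ℝ :=
  ∑ σ : Fin N → Bool, pm N m σ * Real.exp (ham N β m g σ)

/-- The set `S_{N,m,ε}` of configurations whose empirical magnetization is `ε`-close to `m`. -/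
def SNset (N : ℕ) (m ε : ℝ) : Finset (Fin N → Bool) :=
  Finset.univ.filter fun σ =>
    (N : ℝ)⁻¹ * (∑ i : Fin N, spin (σ i)) ∈ Set.Icc (m - ε) (m + ε)

/-- The restricted partition function `Z^{≤ε}_{N,β,m}`. -/
def Zres (N : ℕ) (β m ε : ℝ) (g : Fin N × Fin N → ℝ) : ℝ :=
  ∑ σ ∈ SNset N m ε, pm N m σ * Real.exp (ham N β m g σ)

/-- The quenched free energy `E[(1/N) log Z_{N,β,m}]`. -/
def F (N : ℕ) (β m : ℝ) : ℝ :=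
  ∫ g, (N : ℝ)⁻¹ * Real.log (Z N β m g) ∂(couplings N)

/-- The restricted quenched free energy `F^{≤ε}_{N,β,m} = E[(1/N) log Z^{≤ε}_{N,β,m}]`. -/
def Fres (N : ℕ) (β m ε : ℝ) : ℝ :=
  ∫ g, (N : ℝ)⁻¹ * Real.log (Zres N β m ε g) ∂(couplings N)

/-- The binary entropy function `I`. -/
def binEnt (s : ℝ) : ℝ :=
  -((1 + s) / 2) * Real.log ((1 + s) / 2) - ((1 - s) / 2) * Real.log ((1 - s) / 2)

/-- The centered Gaussian field `X_σ = (2N)^{-1/2} Σ_{ij} g_{ij} σ̂_i σ̂_j`. -/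
def Xg (N : ℕ) (m : ℝ) (g : Fin N × Fin N → ℝ) (σ : Fin N → Bool) : ℝ :=
  (Real.sqrt (2 * N))⁻¹ * ∑ i : Fin N, ∑ j : Fin N,
    g (i, j) * (spin (σ i) - m) * (spin (σ j) - m)

/-- The maximum `M_{N,m,ε} = max {X_σ : σ ∈ S_{N,m,ε}}`. -/
def Mmax (N : ℕ) (m ε : ℝ) (g : Fin N × Fin N → ℝ) : ℝ :=
  sSup ((fun σ => Xg N m g σ) '' (SNset N m ε : Set (Fin N → Bool)))

end

section Entropy

lemma binEnt_eq_binEntropy (s : ℝ) : binEnt s = binEntropy ((1 + s) / 2) := by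
  rw [binEnt, binEntropy_eq_negMulLog_add_negMulLog_one_sub, negMulLog, negMulLog,
    show 1 - (1 + s) / 2 = (1 - s) / 2 by ring]
  ring

lemma binEnt_abs (s : ℝ) : binEnt |s| = binEnt s := by
  rcases abs_choice s with h | h
  · rw [h]
  · rw [h, binEnt, binEnt]
    ring_nf

lemma binEnt_lt_of_lt_abs {s t : ℝ} (hs : 0 ≤ s) (hst : s < |t|) (ht : |t| ≤ 1) :
    binEnt t < binEnt s := by
  rw [← binEnt_abs t, binEnt_eq_binEntropy, binEnt_eq_binEntropy]
  apply binEntropy_strictAntiOn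
  · constructor <;> linarith
  · constructor <;> linarith
  · linarith

end Entropy

lemma exists_mem_Ioo_lt_of_hasDerivAt_pos {f : ℝ → ℝ} {f' a b : ℝ} (hab : a < b)
    (hf : HasDerivAt f f' b) (hf' : 0 < f') : ∃ x ∈ Set.Ioo a b, f x < f b := by
  have h := (hasDerivAt_iff_tendsto_slope_left_right.1 hf).1
  have h1 : ∀ᶠ x in nhdsWithin b (Set.Iio b), x ∈ Set.Ioo a b := Ioo_mem_nhdsLT hab
  obtain ⟨x, hx, hxI⟩ := ((h.eventually (lt_mem_nhds hf')).and h1).exists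
  refine ⟨x, hxI, ?_⟩
  rw [slope_comm, slope_def_field] at hx
  have h2 : 0 < b - x := sub_pos.2 hxI.2
  have := (div_pos_iff_of_pos_right h2).1 hx
  linarith

lemma rpow_sum_le_sum_rpow_of_le_one {ι : Type*} (s : Finset ι) {f : ι → ℝ} {θ : ℝ}
    (hf : ∀ i, 0 ≤ f i) (h0 : 0 < θ) (h1 : θ ≤ 1) :
    (∑ i ∈ s, f i) ^ θ ≤ ∑ i ∈ s, f i ^ θ := by
  classical
  induction s using Finset.induction_on with
  | empty => simp [zero_rpow h0.ne']
  | insert i s hi ih =>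
    rw [Finset.sum_insert hi, Finset.sum_insert hi]
    exact (rpow_add_le_add_rpow (hf i) (Finset.sum_nonneg fun j _ => hf j) h0.le h1).trans
      (by gcongr)

section Gaussian

instance (N : ℕ) : IsProbabilityMeasure (couplings N) := by
  unfold couplings; infer_instance

lemma integrable_exp_linear_couplings {N : ℕ} (c : Fin N × Fin N → ℝ) :
    Integrable (fun g => exp (∑ k, c k * g k)) (couplings N) := by
  simp_rw [exp_sum]
  exact Integrable.fintype_prod (f := fun k x => exp (c k * x))
    fun k => integrable_exp_mul_gaussianReal (c k)

lemma integral_exp_linear_couplings {N : ℕ} (c : Fin N × Fin N → ℝ) :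
    ∫ g, exp (∑ k, c k * g k) ∂couplings N = exp ((2 * N : ℝ)⁻¹ * ∑ k, c k ^ 2) := by
  simp_rw [exp_sum, couplings]
  rw [integral_fintype_prod_eq_prod (fun k x => exp (c k * x)), Finset.mul_sum, exp_sum]
  refine Finset.prod_congr rfl fun k _ => ?_
  have h := congrFun (mgf_fun_id_gaussianReal (μ := 0) (v := (N : ℝ≥0)⁻¹)) (c k)
  rw [mgf] at h
  rw [h]
  push_cast
  rw [mul_inv]
  ring_nf

end Gaussian

section Hamiltonian

variable {N : ℕ} {m : ℝ}

lemma ham_eq (β m : ℝ) (g : Fin N × Fin N → ℝ) (σ : Fin N → Bool) :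
    ham N β m g σ =
      ∑ k : Fin N × Fin N, (β / √2 * ((spin (σ k.1) - m) * (spin (σ k.2) - m))) * g k
        - β ^ 2 / (4 * N) * (∑ i, (spin (σ i) - m) ^ 2) ^ 2 := by
  rw [ham, Fintype.sum_prod_type, sq (∑ i, _), Finset.sum_mul_sum, Finset.mul_sum]
  congr 1
  refine Finset.sum_congr rfl fun i _ => ?_
  rw [Finset.mul_sum]
  exact Finset.sum_congr rfl fun j _ => by ring

lemma exp_mul_ham (β m θ : ℝ) (g : Fin N × Fin N → ℝ) (σ : Fin N → Bool) :
    exp (θ * ham N β m g σ) =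
      exp (-(θ * (β ^ 2 / (4 * N) * (∑ i, (spin (σ i) - m) ^ 2) ^ 2))) *
      exp (∑ k : Fin N × Fin N,
        (θ * (β / √2 * ((spin (σ k.1) - m) * (spin (σ k.2) - m)))) * g k) := by
  rw [← exp_add, ham_eq, mul_sub, Finset.mul_sum, sub_eq_neg_add]
  simp_rw [mul_assoc]

lemma integrable_exp_mul_ham (β m θ : ℝ) (σ : Fin N → Bool) :
    Integrable (fun g => exp (θ * ham N β m g σ)) (couplings N) := by
  simp_rw [exp_mul_ham]
  exact (integrable_exp_linear_couplings _).const_mul _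

lemma integral_exp_mul_ham (β m θ : ℝ) (σ : Fin N → Bool) :
    ∫ g, exp (θ * ham N β m g σ) ∂couplings N =
      exp (-(θ * (1 - θ) * β ^ 2 / 4) * ((∑ i, (spin (σ i) - m) ^ 2) ^ 2 / N)) := by
  simp_rw [exp_mul_ham]
  rw [integral_const_mul, integral_exp_linear_couplings, ← exp_add]
  congr 1
  have h : ∑ k : Fin N × Fin N,
      (θ * (β / √2 * ((spin (σ k.1) - m) * (spin (σ k.2) - m)))) ^ 2 =
      θ ^ 2 * β ^ 2 / 2 * (∑ i, (spin (σ i) - m) ^ 2) ^ 2 := by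
    rw [Fintype.sum_prod_type, sq (∑ i, _), Finset.sum_mul_sum, Finset.mul_sum]
    refine Finset.sum_congr rfl fun i _ => ?_
    rw [Finset.mul_sum]
    refine Finset.sum_congr rfl fun j _ => ?_
    rw [mul_pow, mul_pow, div_pow, sq_sqrt zero_le_two]
    ring
  rw [h, mul_inv, div_eq_mul_inv, mul_inv, div_eq_mul_inv _ (N : ℝ)]
  ring

lemma weight_pos (hm : m ∈ Set.Ioo (-1 : ℝ) 1) (b : Bool) : 0 < (1 + m * spin b) / 2 := by
  obtain ⟨h1, h2⟩ := hm
  cases b <;> simp [spin] <;> linarith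

lemma pm_pos (hm : m ∈ Set.Ioo (-1 : ℝ) 1) (σ : Fin N → Bool) : 0 < pm N m σ :=
  Finset.prod_pos fun i _ => weight_pos hm (σ i)

lemma sum_prod_apply (f : Bool → ℝ) : ∑ σ : Fin N → Bool, ∏ i, f (σ i) = (∑ b, f b) ^ N := by
  simpa [-Fintype.univ_bool] using (Finset.sum_pow' Finset.univ f N).symm

lemma sum_pm : ∑ σ : Fin N → Bool, pm N m σ = 1 := by
  simp_rw [pm]
  rw [sum_prod_apply fun b => (1 + m * spin b) / 2]
  have : ∑ b, (1 + m * spin b) / 2 = 1 := by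
    simp [spin]; ring
  rw [this, one_pow]

lemma Z_pos (hm : m ∈ Set.Ioo (-1 : ℝ) 1) (β : ℝ) (g : Fin N × Fin N → ℝ) : 0 < Z N β m g :=
  Finset.sum_pos (fun σ _ => mul_pos (pm_pos hm σ) (exp_pos _)) Finset.univ_nonempty

lemma abs_log_Z_le (hm : m ∈ Set.Ioo (-1 : ℝ) 1) (β : ℝ) (g : Fin N × Fin N → ℝ) :
    |log (Z N β m g)| ≤ ∑ σ, |ham N β m g σ| := by
  set B := ∑ σ, |ham N β m g σ|
  have hB : ∀ σ, |ham N β m g σ| ≤ B := fun σ =>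
    Finset.single_le_sum (f := fun σ => |ham N β m g σ|) (fun τ _ => abs_nonneg _)
      (Finset.mem_univ σ)
  rw [abs_le, le_log_iff_exp_le (Z_pos hm β g), log_le_iff_le_exp (Z_pos hm β g)]
  constructor
  · calc exp (-B) = ∑ σ : Fin N → Bool, pm N m σ * exp (-B) := by
          rw [← Finset.sum_mul, sum_pm, one_mul]
      _ ≤ Z N β m g := Finset.sum_le_sum fun σ _ =>
          mul_le_mul_of_nonneg_left (exp_le_exp.2 (abs_le.1 (hB σ)).1) (pm_pos hm σ).le
  · calc Z N β m g ≤ ∑ σ : Fin N → Bool, pm N m σ * exp B := Finset.sum_le_sum fun σ _ =>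
          mul_le_mul_of_nonneg_left (exp_le_exp.2 (abs_le.1 (hB σ)).2) (pm_pos hm σ).le
      _ = exp B := by rw [← Finset.sum_mul, sum_pm, one_mul]

lemma integrable_ham (β m : ℝ) (σ : Fin N → Bool) :
    Integrable (fun g => ham N β m g σ) (couplings N) := by
  simp_rw [ham_eq]
  refine (integrable_finsetSum _ fun k _ => Integrable.const_mul ?_ _).sub (integrable_const _)
  exact integrable_comp_eval (μ := fun _ : Fin N × Fin N => gaussianReal 0 (N : ℝ≥0)⁻¹)
    (f := fun x : ℝ => x) ((memLp_id_gaussianReal 1).integrable le_rfl)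

lemma integrable_log_Z (hm : m ∈ Set.Ioo (-1 : ℝ) 1) (β : ℝ) :
    Integrable (fun g => log (Z N β m g)) (couplings N) := by
  refine (integrable_finsetSum Finset.univ fun σ _ => (integrable_ham β m σ).abs).mono' ?_
    (ae_of_all _ fun g => abs_log_Z_le hm β g)
  apply Measurable.aestronglyMeasurable
  unfold Z ham
  fun_prop

end Hamiltonian

section FractionalMoment

variable {N : ℕ} {m : ℝ}

/-- The single-site contribution to the bound on the `θ`-th moment of the partition function,
obtained by linearizing the quadratic variance term around its typical value. -/
noncomputable def siteFactor (β m θ : ℝ) (b : Bool) : ℝ :=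
  ((1 + m * spin b) / 2) ^ θ *
    exp (-(θ * (1 - θ) * β ^ 2 / 4) *
      (2 * (1 - m ^ 2) * (spin b - m) ^ 2 - (1 - m ^ 2) ^ 2))

lemma siteFactor_pos (hm : m ∈ Set.Ioo (-1 : ℝ) 1) (β θ : ℝ) (b : Bool) :
    0 < siteFactor β m θ b :=
  mul_pos (rpow_pos_of_pos (weight_pos hm b) θ) (exp_pos _)

lemma pm_rpow_mul_integral_le (hm : m ∈ Set.Ioo (-1 : ℝ) 1) (hN : 0 < N) {θ : ℝ} (h0 : 0 < θ)
    (h1 : θ ≤ 1) (β : ℝ) (σ : Fin N → Bool) :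
    pm N m σ ^ θ * ∫ g, exp (θ * ham N β m g σ) ∂couplings N ≤
      ∏ i, siteFactor β m θ (σ i) := by
  have hN' : (0 : ℝ) < N := Nat.cast_pos.2 hN
  simp_rw [siteFactor]
  rw [Finset.prod_mul_distrib, ← exp_sum, pm, integral_exp_mul_ham,
    ← finsetProd_rpow _ _ fun i _ => (weight_pos hm (σ i)).le]
  refine mul_le_mul_of_nonneg_left (exp_le_exp.2 ?_)
    (Finset.prod_nonneg fun i _ => rpow_nonneg (weight_pos hm (σ i)).le θ)
  rw [← Finset.mul_sum]
  refine mul_le_mul_of_nonpos_left ?_ ?_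
  · rw [Finset.sum_sub_distrib, ← Finset.mul_sum, Finset.sum_const, Finset.card_univ,
      Fintype.card_fin, nsmul_eq_mul, le_div_iff₀ hN']
    nlinarith [sq_nonneg (∑ i, (spin (σ i) - m) ^ 2 - N * (1 - m ^ 2))]
  · have : 0 ≤ θ * (1 - θ) * β ^ 2 / 4 := by
      have := sub_nonneg.2 h1
      positivity
    linarith

lemma F_le (hm : m ∈ Set.Ioo (-1 : ℝ) 1) (hN : 0 < N) {θ : ℝ} (h0 : 0 < θ) (h1 : θ ≤ 1)
    (β : ℝ) : F N β m ≤ θ⁻¹ * log (∑ b, siteFactor β m θ b) := by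
  have hN' : (0 : ℝ) < N := Nat.cast_pos.2 hN
  set φ := ∑ b, siteFactor β m θ b
  have hφ : 0 < φ := Finset.sum_pos (fun b _ => siteFactor_pos hm β θ b) Finset.univ_nonempty
  set W : (Fin N × Fin N → ℝ) → ℝ := fun g => ∑ σ, pm N m σ ^ θ * exp (θ * ham N β m g σ)
  have hWint : Integrable W (couplings N) :=
    integrable_finsetSum _ fun σ _ => (integrable_exp_mul_ham β m θ σ).const_mul _
  have hW : ∫ g, W g ∂couplings N ≤ φ ^ N := by
    rw [integral_finsetSum _ fun σ _ => (integrable_exp_mul_ham β m θ σ).const_mul _,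
      ← sum_prod_apply]
    refine Finset.sum_le_sum fun σ _ => ?_
    rw [integral_const_mul]
    exact pm_rpow_mul_integral_le hm hN h0 h1 β σ
  have hpt : ∀ g, θ * log (Z N β m g) ≤ (φ ^ N)⁻¹ * W g + (N * log φ - 1) := by
    intro g
    have hZ := rpow_pos_of_pos (Z_pos hm β g) θ
    have hZW : Z N β m g ^ θ ≤ W g := by
      refine (rpow_sum_le_sum_rpow_of_le_one _
        (fun σ => (mul_pos (pm_pos hm σ) (exp_pos _)).le) h0 h1).trans_eq ?_
      refine Finset.sum_congr rfl fun σ _ => ?_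
      rw [mul_rpow (pm_pos hm σ).le (exp_pos _).le, ← exp_mul, mul_comm θ]
    have hl := log_le_sub_one_of_pos (x := (φ ^ N)⁻¹ * Z N β m g ^ θ) (by positivity)
    rw [log_mul (by positivity) hZ.ne', log_inv, log_pow, log_rpow (Z_pos hm β g)] at hl
    have : (φ ^ N)⁻¹ * Z N β m g ^ θ ≤ (φ ^ N)⁻¹ * W g := by gcongr
    linarith
  have hmain : θ * ∫ g, log (Z N β m g) ∂couplings N ≤ N * log φ := by
    calc θ * ∫ g, log (Z N β m g) ∂couplings N
        = ∫ g, θ * log (Z N β m g) ∂couplings N := (integral_const_mul _ _).symm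
      _ ≤ ∫ g, ((φ ^ N)⁻¹ * W g + (N * log φ - 1)) ∂couplings N :=
          integral_mono ((integrable_log_Z hm β).const_mul θ)
            ((hWint.const_mul _).add (integrable_const _)) hpt
      _ = (φ ^ N)⁻¹ * ∫ g, W g ∂couplings N + (N * log φ - 1) := by
          rw [integral_add (hWint.const_mul _) (integrable_const _), integral_const_mul]
          simp
      _ ≤ (φ ^ N)⁻¹ * φ ^ N + (N * log φ - 1) := by gcongr
      _ = N * log φ := by
          rw [inv_mul_cancel₀ (by positivity)]
          ring
  rw [F, integral_const_mul, inv_mul_le_iff₀ hN', mul_left_comm, ← div_eq_inv_mul,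
    le_div_iff₀ h0]
  linarith

lemma sum_siteFactor_one (β m : ℝ) : ∑ b, siteFactor β m 1 b = 1 := by
  simp [siteFactor, spin]
  ring

lemma hasDerivAt_sum_siteFactor (hm : m ∈ Set.Ioo (-1 : ℝ) 1) (β : ℝ) :
    HasDerivAt (fun θ => ∑ b, siteFactor β m θ b)
      (β ^ 2 * (1 - m ^ 2) ^ 2 / 4 - binEnt m) 1 := by
  have hb : ∀ b, HasDerivAt (fun θ => siteFactor β m θ b)
      ((1 + m * spin b) / 2 * log ((1 + m * spin b) / 2) +
        (1 + m * spin b) / 2 * (β ^ 2 / 4 *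
          (2 * (1 - m ^ 2) * (spin b - m) ^ 2 - (1 - m ^ 2) ^ 2))) 1 := by
    intro b
    have hp := (hasDerivAt_id (1 : ℝ)).const_rpow (weight_pos hm b)
    have he := (((((hasDerivAt_id (1 : ℝ)).mul ((hasDerivAt_id (1 : ℝ)).const_sub 1)).mul_const
      (β ^ 2)).div_const 4).neg.mul_const
        (2 * (1 - m ^ 2) * (spin b - m) ^ 2 - (1 - m ^ 2) ^ 2)).exp
    refine (hp.mul he).congr_deriv ?_
    simp
    ring
  refine (HasDerivAt.fun_sum fun b _ => hb b).congr_deriv ?_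
  simp only [Fintype.sum_bool, spin, binEnt]
  norm_num
  ring_nf

end FractionalMoment

/-- if `m_* ∈ (0,1)` satisfies `I(m_*) = 1/4`, then for every `m ∈ (-1,1)` with
`|m| > m_*` there is `β` in the AT region `AT_m` which is not in the high temperature
region `HT_m`. -/
theorem statement0 (mstar : ℝ) (hms : mstar ∈ Set.Ioo (0 : ℝ) 1) (hmsI : binEnt mstar = 1 / 4)
    (m : ℝ) (hm : m ∈ Set.Ioo (-1 : ℝ) 1) (hmm : mstar < |m|) :
    ∃ β : ℝ, 0 ≤ β ∧ β ^ 2 * (1 - m ^ 2) ^ 2 ≤ 1 ∧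
      ¬ Tendsto (fun N : ℕ => F N β m) atTop (nhds 0) := by
  have ha : 0 < 1 - m ^ 2 := by nlinarith [hm.1, hm.2]
  have hβ : ((1 - m ^ 2)⁻¹) ^ 2 * (1 - m ^ 2) ^ 2 = 1 := by
    rw [← mul_pow, inv_mul_cancel₀ ha.ne', one_pow]
  refine ⟨(1 - m ^ 2)⁻¹, (inv_pos.2 ha).le, hβ.le, fun hlim => ?_⟩
  have hent := binEnt_lt_of_lt_abs hms.1.le hmm (abs_lt.2 hm).le
  obtain ⟨θ, hθ, hlt⟩ := exists_mem_Ioo_lt_of_hasDerivAt_pos zero_lt_one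
    (hasDerivAt_sum_siteFactor hm (1 - m ^ 2)⁻¹) (by rw [hβ]; linarith)
  rw [sum_siteFactor_one] at hlt
  have hpos : 0 < ∑ b, siteFactor (1 - m ^ 2)⁻¹ m θ b :=
    Finset.sum_pos (fun b _ => siteFactor_pos hm _ θ b) Finset.univ_nonempty
  have hneg : θ⁻¹ * log (∑ b, siteFactor (1 - m ^ 2)⁻¹ m θ b) < 0 :=
    mul_neg_of_pos_of_neg (inv_pos.2 hθ.1) (log_neg hpos hlt)
  refine hneg.not_ge (le_of_tendsto (hlim.comp (tendsto_add_atTop_nat 1)) ?_)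
  exact Eventually.of_forall fun N => F_le hm N.succ_pos hθ.1 hθ.2.le _
end

section
/- For every N ∈ ℕ, β ≥ 0, m ∈ (−1,1), ε > 0 and δ > 0, P(|(1/N) log Z_{N,β,m} − (1/N) log Z^{≤ε}_{N,β,m}| ≥ δ) ≤ P(Z^{≤ε}_{N,β,m} ≤ e^{−δN}) + (1 − e^{−δN})^{−1} · p_m(S_{N,m,ε}^∁), where p_m(S_{N,m,ε}^∁) = Σ_{σ∉S_{N,m,ε}} p_m(σ). -/
open MeasureTheory ProbabilityTheory Real Filter
open scoped NNReal

/-- The affine Gaussian exponential `exp (a x - v a² / 2)` is integrable. -/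
theorem integrable_exp_sub_gaussianReal (v : ℝ≥0) (a : ℝ) :
    Integrable (fun x => Real.exp (a * x - v * a ^ 2 / 2)) (gaussianReal 0 v) := by
  simp only [Real.exp_sub]
  exact (integrable_exp_mul_gaussianReal a).div_const _

/-- The affine Gaussian exponential `exp (a x - v a² / 2)` has mean one. -/
theorem integral_exp_sub_gaussianReal (v : ℝ≥0) (a : ℝ) :
    ∫ x, Real.exp (a * x - v * a ^ 2 / 2) ∂(gaussianReal 0 v) = 1 := by
  have h : ∫ x, Real.exp (a * x) ∂(gaussianReal 0 v) = Real.exp (v * a ^ 2 / 2) := by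
    have := congrFun (mgf_id_gaussianReal (μ := 0) (v := v)) a
    simpa [mgf] using this
  simp only [Real.exp_sub]
  rw [integral_div, h, div_self (Real.exp_ne_zero _)]

instance isProbabilityMeasure_couplings (N : ℕ) : IsProbabilityMeasure (couplings N) := by
  unfold couplings; infer_instance

/-- The Gibbs weight factorizes over the couplings. -/
theorem exp_ham_eq_prod (N : ℕ) (β m : ℝ) (g : Fin N × Fin N → ℝ) (σ : Fin N → Bool) :
    Real.exp (ham N β m g σ) = ∏ p : Fin N × Fin N,
      Real.exp (β / √2 * ((spin (σ p.1) - m) * (spin (σ p.2) - m)) * g p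
        - ((N : ℝ≥0)⁻¹ : ℝ≥0) * (β / √2 * ((spin (σ p.1) - m) * (spin (σ p.2) - m))) ^ 2 / 2) := by
  rw [← Real.exp_sum, ham]
  congr 1
  simp only [Fintype.sum_prod_type, Finset.mul_sum, ← Finset.sum_sub_distrib]
  refine Finset.sum_congr rfl fun i _ => Finset.sum_congr rfl fun j _ => ?_
  rw [mul_pow, div_pow, Real.sq_sqrt zero_le_two]
  push_cast
  ring

theorem integrable_exp_ham (N : ℕ) (β m : ℝ) (σ : Fin N → Bool) :
    Integrable (fun g => Real.exp (ham N β m g σ)) (couplings N) := by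
  simp only [exp_ham_eq_prod, couplings]
  exact Integrable.fintype_prod fun p => integrable_exp_sub_gaussianReal _ _

/-- The Gibbs weight of every configuration has mean one. -/
theorem integral_exp_ham (N : ℕ) (β m : ℝ) (σ : Fin N → Bool) :
    ∫ g, Real.exp (ham N β m g σ) ∂(couplings N) = 1 := by
  simp only [exp_ham_eq_prod, couplings]
  rw [integral_fintype_prod_eq_prod (fun (p : Fin N × Fin N) x =>
      Real.exp (β / √2 * ((spin (σ p.1) - m) * (spin (σ p.2) - m)) * x
        - ((N : ℝ≥0)⁻¹ : ℝ≥0) * (β / √2 * ((spin (σ p.1) - m) * (spin (σ p.2) - m))) ^ 2 / 2))]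
  exact Finset.prod_eq_one fun p _ => integral_exp_sub_gaussianReal _ _

theorem pm_nonneg (N : ℕ) {m : ℝ} (hm : m ∈ Set.Ioo (-1 : ℝ) 1) (σ : Fin N → Bool) :
    0 ≤ pm N m σ := by
  refine Finset.prod_nonneg fun i _ => ?_
  obtain ⟨h₁, h₂⟩ := hm
  unfold spin
  split_ifs <;> linarith

/-- If `e^{-t} < z ≤ w` and `log w - log z` is at least `t > 0` in absolute value, then
`w - z` is at least `1 - e^{-t}`. -/
theorem one_sub_exp_neg_le_sub {w z t : ℝ} (hzw : z ≤ w) (hz : Real.exp (-t) < z)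
    (ht : 0 < t) (h : t ≤ |Real.log w - Real.log z|) : 1 - Real.exp (-t) ≤ w - z := by
  have hz0 : 0 < z := (Real.exp_pos _).trans hz
  have hw0 : 0 < w := hz0.trans_le hzw
  rw [abs_of_nonneg (sub_nonneg.2 (Real.log_le_log hz0 hzw)), ← Real.log_div hw0.ne' hz0.ne',
    Real.le_log_iff_exp_le (div_pos hw0 hz0), le_div_iff₀ hz0] at h
  have h1 : Real.exp t * Real.exp (-t) = 1 := by rw [← Real.exp_add]; simp
  have h2 : 1 < Real.exp t := Real.one_lt_exp_iff.2 ht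
  nlinarith

/-- the first restriction estimate
`P(|(1/N) log Z - (1/N) log Z^{≤ε}| ≥ δ) ≤ P(Z^{≤ε} ≤ e^{-δN}) + (1-e^{-δN})⁻¹ p_m(S^∁)`. -/
theorem statement15 (N : ℕ) (hN : 0 < N) (β m ε δ : ℝ) (hβ : 0 ≤ β)
    (hm : m ∈ Set.Ioo (-1 : ℝ) 1) (hε : 0 < ε) (hδ : 0 < δ) :
    (couplings N {g | δ ≤
        |(N : ℝ)⁻¹ * Real.log (Z N β m g) - (N : ℝ)⁻¹ * Real.log (Zres N β m ε g)|}).toReal ≤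
      (couplings N {g | Zres N β m ε g ≤ Real.exp (-δ * N)}).toReal
        + (1 - Real.exp (-δ * N))⁻¹ * ∑ σ ∈ (SNset N m ε)ᶜ, pm N m σ := by
  have hN' : (0 : ℝ) < N := Nat.cast_pos.2 hN
  have ht : 0 < δ * N := mul_pos hδ hN'
  set R : (Fin N × Fin N → ℝ) → ℝ :=
    fun g => ∑ σ ∈ (SNset N m ε)ᶜ, pm N m σ * Real.exp (ham N β m g σ) with hR
  have hR0 (g) : 0 ≤ R g :=
    Finset.sum_nonneg fun σ _ => mul_nonneg (pm_nonneg N hm σ) (Real.exp_pos _).le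
  have hZ (g) : Z N β m g = Zres N β m ε g + R g := (Finset.sum_add_sum_compl _ _).symm
  have hint (σ : Fin N → Bool) :
      Integrable (fun g => pm N m σ * Real.exp (ham N β m g σ)) (couplings N) :=
    (integrable_exp_ham N β m σ).const_mul _
  have hRint : Integrable R (couplings N) := integrable_finsetSum _ fun σ _ => hint σ
  have hRmean : ∫ g, R g ∂(couplings N) = ∑ σ ∈ (SNset N m ε)ᶜ, pm N m σ := by
    rw [hR, integral_finsetSum _ fun σ _ => hint σ]
    simp [integral_const_mul, integral_exp_ham]
  have hc : 0 < 1 - Real.exp (-δ * N) := by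
    rw [sub_pos, Real.exp_lt_one_iff]; linarith
  have hsub : {g | δ ≤
        |(N : ℝ)⁻¹ * Real.log (Z N β m g) - (N : ℝ)⁻¹ * Real.log (Zres N β m ε g)|} ⊆
      {g | Zres N β m ε g ≤ Real.exp (-δ * N)} ∪ {g | 1 - Real.exp (-δ * N) ≤ R g} := by
    intro g hg
    by_cases hz : Zres N β m ε g ≤ Real.exp (-δ * N)
    · exact Or.inl hz
    right
    rw [Set.mem_ofPred_eq, ← mul_sub, abs_mul, abs_of_pos (inv_pos.2 hN'),
      le_inv_mul_iff₀' hN'] at hg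
    rw [not_le, neg_mul] at hz
    have := one_sub_exp_neg_le_sub (by linarith [hR0 g, hZ g]) hz ht hg
    rw [hZ, add_sub_cancel_left] at this
    simpa only [Set.mem_ofPred_eq, neg_mul] using this
  have hmarkov := mul_meas_ge_le_integral_of_nonneg (Eventually.of_forall hR0) hRint
    (1 - Real.exp (-δ * N))
  rw [hRmean] at hmarkov
  calc _ ≤ (couplings N).real ({g | Zres N β m ε g ≤ Real.exp (-δ * N)} ∪
        {g | 1 - Real.exp (-δ * N) ≤ R g}) := measureReal_mono hsub
    _ ≤ _ := measureReal_union_le _ _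
    _ ≤ _ := by
      refine add_le_add le_rfl ?_
      rwa [le_inv_mul_iff₀ hc]
end
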